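/- Let ρ, σ ≥ 0, κ ∈ ℝ, and let K_κ denote the canonical additive map from G_ρ to G_σ (K_κ(t) = ((1 + ρ·t)^κ − 1)/σ when ρ, σ > 0, and K_κ(t) = κ·t when ρ = σ = 0). Let Σ ⊆ (0, ∞) be Lebesgue-measurable with λ(Σ ∩ (0, δ)) > 0 for every δ > 0, and let S : G_ρ → G_σ be subadditive with S(0) = 0 and S(s) ≤ K_κ(s) for all s ∈ Σ. Then S(x) ≤ K_κ(x) for all x > 0; in particular limsup_{x ↓ 0} S(x) ≤ 0, so that S(t) → 0 as t ↓ 0. If in addition there exists a sequence z_n < 0 with z_n ↑ 0 and S(z_n) → 0, then S is continuous at 0 and hence continuous at every point of G_ρ. -/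

import Mathlib

open Filter Topology MeasureTheory

/-- A Steinhaus theorem for sums: `A + B` contains a ball whenever `A` and `B` have positive
measure. -/
theorem exists_add_mem_nhds_of_volume_pos {A B : Set ℝ} (hA : MeasurableSet A)
    (hB : MeasurableSet B) (hA0 : volume A ≠ 0) (hB0 : volume B ≠ 0) :
    ∃ z : ℝ, {t | ∃ a ∈ A, ∃ b ∈ B, a + b = t} ∈ 𝓝 z := by
  set P : Set (ℝ × ℝ) := {p | -p.2 ∈ A ∧ p.1 + p.2 ∈ B} with hP
  have hPm : MeasurableSet P :=
    (measurable_snd.neg hA).inter ((measurable_fst.add measurable_snd) hB)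
  have hpres := measurePreserving_add_prod_neg (volume : Measure ℝ) (volume : Measure ℝ)
  have hPpos : (volume.prod volume) P ≠ 0 := by
    have hpre : (fun z : ℝ × ℝ => (z.2 + z.1, -z.1)) ⁻¹' P = A ×ˢ B := by
      ext ⟨x, y⟩
      simp [hP]
    rw [← hpres.measure_preimage hPm.nullMeasurableSet, hpre, Measure.prod_prod]
    exact mul_ne_zero hA0 hB0
  obtain ⟨z, hz⟩ : ∃ z : ℝ, volume (Prod.mk z ⁻¹' P) ≠ 0 := by
    by_contra! h
    exact hPpos ((Measure.measure_prod_null hPm).2 (Eventually.of_forall h))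
  have hC := Measure.sub_mem_nhds_zero_of_addHaar_pos volume (Prod.mk z ⁻¹' P)
    (measurable_prodMk_left hPm) (pos_iff_ne_zero.2 hz)
  refine ⟨z, ?_⟩
  have hlim : Tendsto (fun t : ℝ => t - z) (𝓝 z) (𝓝 0) := by
    simpa using (continuous_id.sub continuous_const).tendsto (f := fun t : ℝ => t - z) z
  filter_upwards [hlim hC] with t ht
  obtain ⟨c, hc, d, hd, hcd⟩ := Set.mem_sub.1 ht
  refine ⟨-d, hd.1, z + c, hc.2, ?_⟩
  linarith

/-- An additively closed set containing a measurable set of positive measure arbitrarily close to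
`0` on the right contains the positive half-line. -/
theorem Ioi_subset_of_add_mem_of_volume_pos {P T : Set ℝ}
    (hP : ∀ x ∈ P, ∀ y ∈ P, x + y ∈ P) (hTP : T ⊆ P) (hT : MeasurableSet T)
    (hpos : ∀ δ > (0 : ℝ), volume (T ∩ Set.Ioo 0 δ) ≠ 0) : Set.Ioi 0 ⊆ P := by
  intro x hx
  have hx : 0 < x := hx
  have hm : MeasurableSet (T ∩ Set.Ioo 0 (x / 2)) := hT.inter measurableSet_Ioo
  have hx2 := hpos (x / 2) (by positivity)
  obtain ⟨z, hz⟩ := exists_add_mem_nhds_of_volume_pos hm hm hx2 hx2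
  have hzx : z < x := by
    obtain ⟨a, ha, b, hb, rfl⟩ := mem_of_mem_nhds hz
    linarith [ha.2.2, hb.2.2]
  obtain ⟨η, hη, hball⟩ := Metric.mem_nhds_iff.1 hz
  obtain ⟨s, hsT, hs0, hsη⟩ := nonempty_of_measure_ne_zero (hpos η hη)
  have hadd : ∀ n : ℕ, ∀ y ∈ P, y + n * s ∈ P := by
    intro n
    induction n with
    | zero => intro y hy; simpa using hy
    | succ n ih =>
      intro y hy
      have := hP _ (ih y hy) s (hTP hsT)
      convert! this using 1
      push_cast
      ring
  set n := ⌊(x - z) / s⌋₊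
  have h1 : n * s ≤ x - z :=
    (le_div_iff₀ hs0).1 (Nat.floor_le (div_nonneg (by linarith) hs0.le))
  have h2 : x - z < (n + 1) * s := (div_lt_iff₀ hs0).1 (Nat.lt_floor_add_one _)
  have hmem : x - n * s ∈ P := by
    obtain ⟨a, ha, b, hb, hab⟩ := hball (show x - n * s ∈ Metric.ball z η by
      rw [Metric.mem_ball, Real.dist_eq, abs_lt]
      constructor <;> linarith)
    rw [← hab]
    exact hP a (hTP ha.1) b (hTP hb.1)
  simpa using hadd n _ hmem

theorem subadditive_le_linear_of_le_on {f : ℝ → ℝ} {c : ℝ} {T : Set ℝ}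
    (hf : ∀ u v, f (u + v) ≤ f u + f v) (hT : MeasurableSet T)
    (hpos : ∀ δ > (0 : ℝ), volume (T ∩ Set.Ioo 0 δ) ≠ 0) (hle : ∀ u ∈ T, f u ≤ c * u) :
    ∀ u > 0, f u ≤ c * u :=
  fun _ hu => Ioi_subset_of_add_mem_of_volume_pos (P := {u | f u ≤ c * u})
    (fun x (hx : f x ≤ c * x) y (hy : f y ≤ c * y) =>
      show f (x + y) ≤ c * (x + y) by linarith [hf x y]) hle hT hpos hu

theorem subadditive_tendsto_nhdsGT_zero {f : ℝ → ℝ} {c : ℝ}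
    (hf : ∀ u v, f (u + v) ≤ f u + f v) (hf0 : f 0 = 0) (hle : ∀ u > 0, f u ≤ c * u) :
    Tendsto f (𝓝[>] 0) (𝓝 0) := by
  have habs : ∀ u ≥ 0, f u ≤ |c| * u := by
    intro u hu
    rcases hu.eq_or_lt with rfl | hu
    · simp [hf0]
    · exact (hle u hu).trans (by gcongr; exact le_abs_self c)
  have hmul : ∀ (n : ℕ) (h : ℝ), f (n * h) ≤ n * f h := by
    intro n h
    induction n with
    | zero => simp [hf0]
    | succ n ih =>
      have := hf (n * h) h
      push_cast
      rw [add_mul, add_mul, one_mul, one_mul]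
      linarith
  rw [tendsto_order]
  constructor
  · intro ε hε
    obtain ⟨n, hn⟩ := exists_nat_gt (max 0 ((f 1 - |c|) / ε))
    have hn0 : (0 : ℝ) < n := (le_max_left _ _).trans_lt hn
    have hn1 : n * ε < f 1 - |c| :=
      (div_lt_iff_of_neg hε).1 ((le_max_right _ _).trans_lt hn)
    filter_upwards [Ioo_mem_nhdsGT (show (0 : ℝ) < 1 / n by positivity)] with h hh
    have hnh : n * h < 1 := by
      have := (lt_div_iff₀ hn0).1 hh.2
      linarith
    have h1 := hf (n * h) (1 - n * h)
    rw [add_sub_cancel] at h1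
    have h2 := habs (1 - n * h) (by linarith)
    have h3 : 0 ≤ |c| * (n * h) := by have := hh.1; positivity
    have h4 : n * ε < n * f h := by linarith [hmul n h]
    exact lt_of_mul_lt_mul_left h4 hn0.le
  · intro ε hε
    have hlim : Tendsto (fun u : ℝ => c * u) (𝓝[>] 0) (𝓝 0) := by
      have : Continuous fun u : ℝ => c * u := by fun_prop
      simpa using (this.tendsto 0).mono_left nhdsWithin_le_nhds
    filter_upwards [hlim.eventually (gt_mem_nhds hε), self_mem_nhdsWithin] with u hu hu0
    exact (hle u hu0).trans_lt hu

theorem subadditive_continuous_of_continuousAt_zero {f : ℝ → ℝ}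
    (hf : ∀ u v, f (u + v) ≤ f u + f v) (hf0 : f 0 = 0) (hc : ContinuousAt f 0) :
    Continuous f := by
  rw [continuous_iff_continuousAt]
  intro x
  have hc' : Tendsto f (𝓝 0) (𝓝 0) := by simpa [ContinuousAt, hf0] using hc
  have h1 : Tendsto (fun t : ℝ => t - x) (𝓝 x) (𝓝 0) := by
    have : Continuous fun t : ℝ => t - x := by fun_prop
    simpa using this.tendsto x
  have h2 : Tendsto (fun t : ℝ => x - t) (𝓝 x) (𝓝 0) := by
    have : Continuous fun t : ℝ => x - t := by fun_prop
    simpa using this.tendsto x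
  refine tendsto_of_tendsto_of_tendsto_of_le_of_le (g := fun t => f x - f (x - t))
    (h := fun t => f x + f (t - x)) ?_ ?_ (fun t => ?_) (fun t => ?_)
  · simpa using tendsto_const_nhds.sub (hc'.comp h2)
  · simpa using tendsto_const_nhds.add (hc'.comp h1)
  · have := hf t (x - t)
    rw [add_sub_cancel] at this
    exact sub_le_iff_le_add.2 this
  · simpa using hf x (t - x)

theorem subadditive_continuousAt_zero_of_tendsto_nhdsLT {ι : Type*} {l : Filter ι} [l.NeBot]
    {f : ℝ → ℝ} {c : ℝ} {z : ι → ℝ}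
    (hf : ∀ u v, f (u + v) ≤ f u + f v) (hf0 : f 0 = 0) (hle : ∀ u > 0, f u ≤ c * u)
    (hz : Tendsto z l (𝓝[<] 0)) (hfz : Tendsto (fun i => f (z i)) l (𝓝 0)) :
    ContinuousAt f 0 := by
  have hright := subadditive_tendsto_nhdsGT_zero hf hf0 hle
  have hleft : Tendsto f (𝓝[<] 0) (𝓝 0) := by
    rw [tendsto_order]
    constructor
    · intro ε hε
      have hneg : Tendsto (fun t : ℝ => -t) (𝓝[<] 0) (𝓝[>] 0) := by
        simpa using tendsto_neg_nhdsLT (a := (0 : ℝ))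
      filter_upwards [(hright.comp hneg).eventually (gt_mem_nhds (neg_pos.2 hε))] with t ht
      have h1 := hf t (-t)
      rw [add_neg_cancel, hf0] at h1
      simp only [Function.comp_apply] at ht
      linarith
    · intro ε hε
      have hcz : Tendsto (fun i => f (z i) + |c| * (-z i)) l (𝓝 0) := by
        have := hfz.add (((hz.mono_right nhdsWithin_le_nhds).neg).const_mul |c|)
        simpa using this
      obtain ⟨i, hi, hi0⟩ := ((hcz.eventually (gt_mem_nhds hε)).and
        (hz.eventually self_mem_nhdsWithin)).exists
      filter_upwards [Ioo_mem_nhdsLT (show z i < 0 from hi0)] with t ht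
      have h1 := hf (z i) (t - z i)
      rw [add_sub_cancel] at h1
      have h2 := hle (t - z i) (sub_pos.2 ht.1)
      have h3 : c * (t - z i) ≤ |c| * (-z i) := by
        have h4 : 0 < t - z i := sub_pos.2 ht.1
        have h5 : t - z i ≤ -z i := by linarith [ht.2]
        gcongr
        exact le_abs_self c
      linarith
  rw [continuousAt_iff_continuous_left'_right']
  exact ⟨by simpa [ContinuousWithinAt, hf0] using hleft,
    by simpa [ContinuousWithinAt, hf0] using hright⟩

/-- The isomorphism from the additive group `ℝ` onto the Popa group `G_a`. -/
noncomputable def popaExp (a u : ℝ) : ℝ := if a = 0 then u else (Real.exp (a * u) - 1) / a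

/-- The isomorphism from the Popa group `G_a` onto the additive group `ℝ`. -/
noncomputable def popaLog (a x : ℝ) : ℝ := if a = 0 then x else Real.log (1 + a * x) / a

theorem one_add_mul_popaExp (a u : ℝ) : 1 + a * popaExp a u = Real.exp (a * u) := by
  unfold popaExp
  split_ifs with h
  · simp [h]
  · field_simp
    ring

theorem one_add_mul_popaExp_pos (a u : ℝ) : 0 < 1 + a * popaExp a u :=
  one_add_mul_popaExp a u ▸ Real.exp_pos _

@[simp] theorem popaExp_zero (a : ℝ) : popaExp a 0 = 0 := by simp [popaExp]

@[simp] theorem popaLog_zero (a : ℝ) : popaLog a 0 = 0 := by simp [popaLog]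

theorem popaLog_popaExp (a u : ℝ) : popaLog a (popaExp a u) = u := by
  unfold popaLog
  rw [one_add_mul_popaExp, Real.log_exp]
  split_ifs with h
  · simp [popaExp, h]
  · field_simp

theorem popaExp_popaLog {a x : ℝ} (hx : 0 < 1 + a * x) : popaExp a (popaLog a x) = x := by
  unfold popaExp popaLog
  split_ifs with h
  · rfl
  · rw [mul_div_cancel₀ _ h, Real.exp_log hx]
    field_simp
    ring

theorem popaExp_add (a u v : ℝ) :
    popaExp a (u + v) = popaExp a u + popaExp a v + a * popaExp a u * popaExp a v := by
  unfold popaExp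
  split_ifs with h
  · simp [h]
  · rw [mul_add, Real.exp_add]
    field_simp
    ring

theorem popaExp_strictMono {a : ℝ} (ha : 0 ≤ a) : StrictMono (popaExp a) := by
  intro u v huv
  unfold popaExp
  split_ifs with h
  · exact huv
  · have ha : 0 < a := lt_of_le_of_ne ha (Ne.symm h)
    gcongr

theorem popaLog_le_iff {a x u : ℝ} (ha : 0 ≤ a) (hx : 0 < 1 + a * x) :
    popaLog a x ≤ u ↔ x ≤ popaExp a u := by
  rw [← (popaExp_strictMono ha).le_iff_le, popaExp_popaLog hx]

theorem popaExp_differentiable (a : ℝ) : Differentiable ℝ (popaExp a) := by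
  unfold popaExp
  split_ifs with h <;> fun_prop

theorem popaExp_continuous (a : ℝ) : Continuous (popaExp a) :=
  (popaExp_differentiable a).continuous

theorem popaLog_continuousAt {a x : ℝ} (hx : 0 < 1 + a * x) : ContinuousAt (popaLog a) x := by
  unfold popaLog
  split_ifs with h
  · exact continuousAt_id
  · exact ((by fun_prop : ContinuousAt (fun x => 1 + a * x) x).log hx.ne').div_const a

theorem popaLog_pos {a x : ℝ} (ha : 0 ≤ a) (hx : 0 < x) : 0 < popaLog a x := by
  have h : 0 < 1 + a * x := by positivity
  rw [← (popaExp_strictMono ha).lt_iff_lt, popaExp_popaLog h, popaExp_zero]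
  exact hx

theorem popaLog_neg {a x : ℝ} (ha : 0 ≤ a) (h : 0 < 1 + a * x) (hx : x < 0) :
    popaLog a x < 0 := by
  rw [← (popaExp_strictMono ha).lt_iff_lt, popaExp_popaLog h, popaExp_zero]
  exact hx

theorem eventually_one_add_mul_pos {a x : ℝ} (hx : 0 < 1 + a * x) :
    ∀ᶠ y in 𝓝 x, 0 < 1 + a * y :=
  (by fun_prop : ContinuousAt (fun y => 1 + a * y) x).eventually (lt_mem_nhds hx)

/-- Pulling a set back along `popaExp` preserves having positive measure near `0`. -/
theorem volume_popaExp_preimage_inter_ne_zero {a : ℝ} (ha : 0 ≤ a) {A : Set ℝ}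
    (hA : ∀ δ > (0 : ℝ), 0 < volume (A ∩ Set.Ioo 0 δ)) {δ : ℝ} (hδ : 0 < δ) :
    volume (popaExp a ⁻¹' A ∩ Set.Ioo 0 δ) ≠ 0 := by
  intro h
  have himg := addHaar_image_eq_zero_of_differentiableOn_of_addHaar_eq_zero volume
    (popaExp_differentiable a).differentiableOn h
  have hδ' : 0 < popaExp a δ := by simpa using popaExp_strictMono ha hδ
  refine (hA _ hδ').ne' (measure_mono_null ?_ himg)
  rintro x ⟨hxA, hx0, hxδ⟩
  have hx : popaExp a (popaLog a x) = x := popaExp_popaLog (by positivity)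
  refine ⟨popaLog a x, ⟨?_, popaLog_pos ha hx0, ?_⟩, hx⟩
  · rwa [Set.mem_preimage, hx]
  · rwa [← (popaExp_strictMono ha).lt_iff_lt, hx]

/-- The canonical additive maps between Popa groups are the linear maps of `ℝ` seen through
`popaExp`. -/
theorem exists_popaExp_conj (ρ σ κ : ℝ) (K : ℝ → ℝ)
    (hK : ∀ t : ℝ, K t =
      if ρ = 0 then (if σ = 0 then κ * t else (Real.exp (κ * t) - 1) / σ)
      else (if σ = 0 then κ * Real.log (1 + ρ * t)
            else ((1 + ρ * t) ^ κ - 1) / σ)) :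
    ∃ c : ℝ, ∀ u, K (popaExp ρ u) = popaExp σ (c * u) := by
  refine ⟨(if ρ = 0 then κ else κ * ρ) / (if σ = 0 then 1 else σ), fun u => ?_⟩
  rw [hK, one_add_mul_popaExp, Real.log_exp, ← Real.exp_mul]
  unfold popaExp
  split_ifs with h1 h2 h2
  · simp
  · congr 3
    field_simp
  · ring
  · congr 3
    field_simp

/-- **Theorem G3.** For `ρ, σ ≥ 0` and `κ : ℝ`, let `K` be the
canonical additive map from `G_ρ` to `G_σ` (with the usual table of forms:
`K(t) = κ·t` if `ρ = σ = 0`, `K(t) = (e^{κt}-1)/σ` if `ρ = 0 < σ`,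
`K(t) = κ·log(1+ρt)` if `σ = 0 < ρ`, and `K(t) = ((1+ρt)^κ - 1)/σ` if
`ρ, σ > 0`). Let `Sg ⊆ (0,∞)` be measurable with `λ(Sg ∩ (0,δ)) > 0` for all
`δ > 0`, and let `S : (G_ρ, ∘_ρ) → (G_σ, ∘_σ)` be subadditive with `S(0) = 0`
and `S ≤ K` on `Sg`. Then `S(x) ≤ K(x)` for all `x > 0`, `S(t) → 0` as `t ↓ 0`,
and if moreover some sequence `z_n < 0`, `z_n ↑ 0`, has `S(z_n) → 0`, then `S`
is continuous at `0` and hence everywhere on `G_ρ`. -/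
theorem thinned_quantifier_weakening (ρ σ κ : ℝ) (hρ : 0 ≤ ρ) (hσ : 0 ≤ σ)
    (K : ℝ → ℝ)
    (hK : ∀ t : ℝ, K t =
      if ρ = 0 then (if σ = 0 then κ * t else (Real.exp (κ * t) - 1) / σ)
      else (if σ = 0 then κ * Real.log (1 + ρ * t)
            else ((1 + ρ * t) ^ κ - 1) / σ))
    (Sg : Set ℝ) (hSgsub : Sg ⊆ Set.Ioi 0) (hSgmeas : MeasurableSet Sg)
    (hSgpos : ∀ δ > (0 : ℝ), 0 < volume (Sg ∩ Set.Ioo 0 δ))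
    (S : ℝ → ℝ) (hS0 : S 0 = 0)
    (hmap : ∀ x : ℝ, 0 < 1 + ρ * x → 0 < 1 + σ * S x)
    (hsub : ∀ x y : ℝ, 0 < 1 + ρ * x → 0 < 1 + ρ * y →
      S (x + y + ρ * x * y) ≤ S x + S y + σ * S x * S y)
    (hbound : ∀ s ∈ Sg, S s ≤ K s) :
    (∀ x > (0 : ℝ), S x ≤ K x) ∧
    Tendsto S (𝓝[>] (0 : ℝ)) (𝓝 0) ∧
    ((∃ z : ℕ → ℝ, (∀ n, z n < 0) ∧ Monotone z ∧
        Tendsto z atTop (𝓝 0) ∧ Tendsto (fun n => S (z n)) atTop (𝓝 0)) →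
      ContinuousAt S 0 ∧ ∀ x : ℝ, 0 < 1 + ρ * x → ContinuousAt S x) := by
  obtain ⟨c, hc⟩ := exists_popaExp_conj ρ σ κ K hK
  set f : ℝ → ℝ := fun u => popaLog σ (S (popaExp ρ u)) with hf_def
  have hEf : ∀ u, popaExp σ (f u) = S (popaExp ρ u) := fun u =>
    popaExp_popaLog (hmap _ (one_add_mul_popaExp_pos ρ u))
  have hS : ∀ x, 0 < 1 + ρ * x → S x = popaExp σ (f (popaLog ρ x)) := fun x hx => by
    rw [hEf, popaExp_popaLog hx]
  have hf0 : f 0 = 0 := by simp [hf_def, hS0]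
  have hf : ∀ u v, f (u + v) ≤ f u + f v := by
    intro u v
    rw [hf_def, popaLog_le_iff hσ (hmap _ (one_add_mul_popaExp_pos ρ _)), popaExp_add,
      popaExp_add]
    change _ ≤ popaExp σ (f u) + popaExp σ (f v) + σ * popaExp σ (f u) * popaExp σ (f v)
    rw [hEf, hEf]
    exact hsub _ _ (one_add_mul_popaExp_pos ρ u) (one_add_mul_popaExp_pos ρ v)
  have hle : ∀ u > 0, f u ≤ c * u := by
    refine subadditive_le_linear_of_le_on hf
      ((popaExp_continuous ρ).measurable hSgmeas)
      (fun δ hδ => volume_popaExp_preimage_inter_ne_zero hρ hSgpos hδ) fun u hu => ?_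
    rw [hf_def, popaLog_le_iff hσ (hmap _ (one_add_mul_popaExp_pos ρ _)), ← hc]
    exact hbound _ hu
  have h0 : (0 : ℝ) < 1 + ρ * 0 := by simp
  have hlog0 : Tendsto (popaLog ρ) (𝓝 0) (𝓝 0) := by
    simpa [ContinuousAt] using popaLog_continuousAt h0
  refine ⟨fun x hx => ?_, ?_, ?_⟩
  · have hx' : 0 < 1 + ρ * x := by positivity
    rw [hS x hx', ← popaExp_popaLog hx', hc, popaExp_popaLog hx']
    exact (popaExp_strictMono hσ).monotone (hle _ (popaLog_pos hρ hx))
  · have hlog : Tendsto (popaLog ρ) (𝓝[>] 0) (𝓝[>] 0) :=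
      tendsto_nhdsWithin_iff.2 ⟨hlog0.mono_left nhdsWithin_le_nhds,
        eventually_mem_nhdsWithin.mono fun x hx => popaLog_pos hρ hx⟩
    have hlim := ((popaExp_continuous σ).tendsto 0).comp
      ((subadditive_tendsto_nhdsGT_zero hf hf0 hle).comp hlog)
    rw [popaExp_zero] at hlim
    refine hlim.congr' ?_
    filter_upwards [nhdsWithin_le_nhds (eventually_one_add_mul_pos h0)] with x hx
    exact (hS x hx).symm
  · rintro ⟨z, hz, -, hz0, hSz⟩
    have hzpos : ∀ᶠ n in atTop, 0 < 1 + ρ * z n :=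
      hz0.eventually (eventually_one_add_mul_pos h0)
    have hlogz : Tendsto (fun n => popaLog ρ (z n)) atTop (𝓝[<] 0) :=
      tendsto_nhdsWithin_iff.2 ⟨hlog0.comp hz0, hzpos.mono fun n hn => popaLog_neg hρ hn (hz n)⟩
    have hfz : Tendsto (fun n => f (popaLog ρ (z n))) atTop (𝓝 0) := by
      have hlogσ : Tendsto (popaLog σ) (𝓝 0) (𝓝 0) := by
        simpa [ContinuousAt] using popaLog_continuousAt (a := σ) (x := 0) (by simp)
      refine (hlogσ.comp hSz).congr' ?_
      filter_upwards [hzpos] with n hn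
      simp only [hf_def, Function.comp_apply, popaExp_popaLog hn]
    have hfc := subadditive_continuous_of_continuousAt_zero hf hf0
      (subadditive_continuousAt_zero_of_tendsto_nhdsLT hf hf0 hle hlogz hfz)
    have hScont : ∀ x : ℝ, 0 < 1 + ρ * x → ContinuousAt S x := by
      intro x hx
      refine (((popaExp_continuous σ).comp hfc).continuousAt.comp
        (popaLog_continuousAt hx)).congr ?_
      filter_upwards [eventually_one_add_mul_pos hx] with y hy
      exact (hS y hy).symm
    exact ⟨hScont 0 h0, hScont⟩
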